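/- Let α > −1 and β > −1 be real numbers and i ≥ 1 an integer. Then for all real x, Σ_{j=1}^{i} [(α+β+2j+2)/((α+β+j+2)_{i+1})] [(α+3)_{j−1} (α+β+3)_j / ((β+1)_{j−1} j!)] P_{i−j}^{(−α−i−2,−β−i−1)}(x) P_{j−1}^{(α+3,β)}(x) = (−1)^{i−1} Σ_{ℓ=0}^{i−1} [(α+3)_{i−ℓ−1} (−α−2)_{i−ℓ−1} / ((β+1)_{i−ℓ−1} (i−ℓ)! ℓ! (i−ℓ−1)!)] [Σ_{m=0}^{ℓ} ((−ℓ)_m (α+i−ℓ+2)_m (α+β+3)_m) / ((β+i−ℓ)_m (i−ℓ+1)_m m!)] ((x−1)/2)^{ℓ}. -/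

import Mathlib

/-- The Pochhammer symbol (rising factorial) `(a)_k = a (a+1) ⋯ (a+k-1)`. -/
noncomputable def poch (a : ℝ) (k : ℕ) : ℝ := (ascPochhammer ℝ k).eval a

/-- The Jacobi polynomial
`P_n^{(α,β)}(x) = Σ_{k=0}^{n} [(n+α+β+1)_k / k!] [(α+k+1)_{n−k} / (n−k)!] ((x−1)/2)^k`,
valid for all real `α`, `β`. -/
noncomputable def jacobiP (α β : ℝ) (n : ℕ) (x : ℝ) : ℝ :=
  ∑ k ∈ Finset.range (n + 1),
    poch ((n : ℝ) + α + β + 1) k / Nat.factorial k *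
      (poch (α + k + 1) (n - k) / Nat.factorial (n - k)) * ((x - 1) / 2) ^ k

lemma poch_zero (a : ℝ) : poch a 0 = 1 := by simp [poch]

lemma poch_succ (a : ℝ) (k : ℕ) : poch a (k + 1) = poch a k * (a + k) :=
  ascPochhammer_succ_eval k a

lemma poch_add (a : ℝ) (m n : ℕ) : poch a (m + n) = poch a m * poch (a + m) n := by
  induction n with
  | zero => simp [poch_zero]
  | succ n ih => rw [← add_assoc, poch_succ, ih, poch_succ]; push_cast; ring

lemma poch_succ_left (a : ℝ) (n : ℕ) : poch a (n + 1) = a * poch (a + 1) n := by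
  rw [add_comm, poch_add, poch_succ, poch_zero]; simp

lemma poch_pos {a : ℝ} (ha : 0 < a) (k : ℕ) : 0 < poch a k := ascPochhammer_pos k a ha

lemma poch_neg (a : ℝ) (n : ℕ) : poch (-a) n = (-1) ^ n * poch (a - n + 1) n := by
  induction n with
  | zero => simp [poch_zero]
  | succ n ih =>
    rw [poch_succ, ih, poch_succ_left]
    push_cast
    rw [show a - (n + 1 : ℝ) + 1 + 1 = a - n + 1 by ring]
    ring

lemma poch_natCast_add_one (k n : ℕ) :
    poch ((k : ℝ) + 1) n = ((k + n).factorial : ℝ) / k.factorial := by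
  rw [eq_div_iff (by positivity)]
  induction n with
  | zero => simp [poch_zero]
  | succ n ih =>
    rw [poch_succ, ← add_assoc, Nat.factorial_succ]
    push_cast
    rw [← ih]
    ring

lemma poch_neg_natCast (k n : ℕ) :
    poch (-((k + n : ℕ) : ℝ)) n = (-1) ^ n * ((k + n).factorial : ℝ) / k.factorial := by
  rw [poch_neg, show ((k + n : ℕ) : ℝ) - n + 1 = k + 1 by push_cast; ring,
    poch_natCast_add_one, mul_div_assoc]

lemma cast_choose_succ_mul (n t s : ℕ) (h : n = t + s) :
    ((n.choose (t + 1) : ℕ) : ℝ) * (t + 1) = n.choose t * s := by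
  have := Nat.choose_succ_right_eq n t
  rw [show n - t = s by omega] at this
  exact_mod_cast this

/-- The Pfaff–Saalschütz summation formula, cleared of denominators. -/
lemma sum_choose_mul_poch_saalschutz (A B C : ℝ) (N : ℕ) :
    ∑ t ∈ Finset.range (N + 1), (N.choose t : ℝ) * poch A t * poch B t * poch (C + t) (N - t) *
      poch (C - A - B) (N - t) = poch (C - A) N * poch (C - B) N := by
  induction N with
  | zero => simp [poch_zero]
  | succ N ih =>
    let G : ℕ → ℝ := fun t => -(t * ((N + 1).choose t : ℝ) / (N + 1)) * poch A t * poch B t *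
      poch (C + t - 1) (N + 1 - t) * poch (C - A - B) (N + 1 - t)
    have key : ∀ t ∈ Finset.range (N + 1), ((N + 1).choose t : ℝ) * poch A t * poch B t *
        poch (C + t) (N + 1 - t) * poch (C - A - B) (N + 1 - t) =
        (C - A + N) * (C - B + N) * ((N.choose t : ℝ) * poch A t * poch B t *
          poch (C + t) (N - t) * poch (C - A - B) (N - t)) + (G (t + 1) - G t) := by
      intro t ht
      obtain ⟨s, hs⟩ := Nat.exists_eq_add_of_le (Nat.lt_succ_iff.mp (Finset.mem_range.mp ht))
      have h1 : (((N + 1).choose (t + 1) : ℕ) : ℝ) * (t + 1) = (N + 1) * N.choose t := by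
        exact_mod_cast (Nat.add_one_mul_choose_eq N t).symm
      have h2 := cast_choose_succ_mul (N + 1) t (s + 1) (by omega)
      have h3 : ((N + 1).choose t : ℝ) = (N + 1) * N.choose t / (s + 1) := by
        rw [eq_div_iff (by positivity), ← h1, h2]; push_cast; rfl
      have h4 : ((t + 1 : ℕ) : ℝ) * ((N + 1).choose (t + 1) : ℝ) = (N + 1) * N.choose t := by
        rw [← h1]; push_cast; ring
      have h5 : C + ((t + 1 : ℕ) : ℝ) - 1 = C + t := by push_cast; ring
      have hN : (N : ℝ) = t + s := by exact_mod_cast hs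
      simp only [G]
      rw [h4, h3, h5, show N + 1 - t = s + 1 by omega, show N + 1 - (t + 1) = s by omega,
        show N - t = s by omega, poch_succ_left (C + t - 1), poch_succ A, poch_succ B,
        poch_succ (C + t) s, poch_succ (C - A - B), sub_add_cancel, hN]
      have : (t + s + 1 : ℝ) ≠ 0 := by positivity
      field_simp
      ring
    rw [Finset.sum_range_succ, Finset.sum_congr rfl key, Finset.sum_add_distrib,
      ← Finset.mul_sum, ih, Finset.sum_range_sub, poch_succ (C - A), poch_succ (C - B)]
    have : (N + 1 : ℝ) ≠ 0 := by positivity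
    simp [G, poch_zero, poch_succ A, poch_succ B, this]
    ring

/-- An alternating sum that telescopes. -/
lemma sum_alternating_choose_div_poch {S : ℝ} (hS : 0 < S) (N : ℕ) :
    ∑ t ∈ Finset.range (N + 2), (-1 : ℝ) ^ t * ((N + 1).choose t : ℝ) * (S + 2 * t) /
      poch (S + t) (N + 2) = 0 := by
  let g : ℕ → ℝ := fun t =>
    -((-1) ^ t * (t * ((N + 1).choose t : ℝ)) / (N + 1) / poch (S + t) (N + 1))
  have key : ∀ t ∈ Finset.range (N + 2), (-1 : ℝ) ^ t * ((N + 1).choose t : ℝ) * (S + 2 * t) /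
      poch (S + t) (N + 2) = g (t + 1) - g t := by
    intro t ht
    obtain ⟨s, hs⟩ := Nat.exists_eq_add_of_le (Nat.lt_succ_iff.mp (Finset.mem_range.mp ht))
    have hc := cast_choose_succ_mul (N + 1) t s hs
    have hsr : (N : ℝ) + 1 = t + s := by exact_mod_cast hs
    have h1 : 0 < poch (S + t + 1) N := poch_pos (by positivity) N
    have h2 : poch (S + t) (N + 2) = (S + t) * poch (S + t + 1) N * (S + t + 1 + N) := by
      rw [poch_succ_left, poch_succ, mul_assoc]
    have h3 : poch (S + t) (N + 1) = (S + t) * poch (S + t + 1) N := poch_succ_left _ _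
    have h4 : poch (S + (t + 1 : ℕ)) (N + 1) = poch (S + t + 1) N * (S + t + 1 + N) := by
      push_cast; rw [← add_assoc, poch_succ]
    simp only [g]
    rw [h2, h3, h4]
    have h5 : ((t + 1 : ℕ) : ℝ) * ((N + 1).choose (t + 1) : ℝ) = (N + 1).choose t * s := by
      rw [← hc]; push_cast; ring
    rw [h5]
    have h6 : (s : ℝ) = N + 1 - t := by linarith
    rw [h6]
    field_simp
    ring
  rw [Finset.sum_congr rfl key, Finset.sum_range_sub]
  simp [g, Nat.choose_succ_self]

lemma sum_alternating_div_factorial {S : ℝ} (hS : 0 < S) (M : ℕ) :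
    ∑ t ∈ Finset.range (M + 1), (-1 : ℝ) ^ t * (S + 2 * t) /
      (poch (S + t) (M + 1) * t.factorial * (M - t).factorial) = if M = 0 then 1 else 0 := by
  rcases M with _ | N
  · simp [poch_succ, poch_zero, hS.ne']
  · rw [if_neg (by omega), ← zero_div ((N + 1).factorial : ℝ),
      ← sum_alternating_choose_div_poch hS N, Finset.sum_div]
    refine Finset.sum_congr rfl fun t ht => ?_
    have hp : 0 < poch (S + t) (N + 1 + 1) := poch_pos (by positivity) _
    rw [Nat.cast_choose ℝ (Nat.lt_succ_iff.mp (Finset.mem_range.mp ht))]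
    field_simp

/-- The `t, r` term of the double sum in `jacobiP_inversion`, for `N = t + r + q`. -/
lemma inversion_term {a b : ℝ} {k : ℕ} (h : 0 < a + b + 1 + k) (x : ℝ) (t r q : ℕ) :
    (a + b + 2 * (k + t : ℝ) + 1) / poch (a + b + 1 + k + t) (k + (t + r + q) + 1) *
      (poch ((r + q : ℝ) + (-a - (k + (t + r + q) : ℝ) - 1) + (-b - (k + (t + r + q) : ℝ) - 1) + 1) r
        / r.factorial * (poch (-a - (k + (t + r + q) : ℝ) - 1 + r + 1) q / q.factorial) * x ^ r) *
      (poch (k + t + a + b + 1) k / k.factorial * (poch (a + k + 1) t / t.factorial)) =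
    (-1) ^ (t + r + q) * x ^ r / (r.factorial * k.factorial) * poch (a + k + 1) (t + q) *
      ((-1 : ℝ) ^ t * (a + b + 1 + 2 * k + 2 * t) /
      (poch (a + b + 1 + 2 * k + t) (t + q + 1) * t.factorial * q.factorial)) := by
  have e1 : (r + q : ℝ) + (-a - (k + (t + r + q) : ℝ) - 1) + (-b - (k + (t + r + q) : ℝ) - 1) + 1
      = -(a + b + 1 + 2 * k + 2 * t + r + q) := by ring
  have e2 : -a - (k + (t + r + q) : ℝ) - 1 + r + 1 = -(a + k + t + q) := by ring
  have e3 : a + b + 1 + 2 * k + 2 * t + r + q - r + 1 = a + b + 1 + k + t + k + (t + q + 1 : ℕ) := by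
    push_cast; ring
  have e4 : a + k + t + q - q + 1 = a + k + 1 + t := by ring
  have e5 : k + (t + r + q) + 1 = k + ((t + q + 1) + r) := by ring
  have e6 : (k : ℝ) + t + a + b + 1 = a + b + 1 + k + t := by ring
  have e7 : a + b + 1 + 2 * k + t = a + b + 1 + k + t + k := by ring
  rw [e1, e2, poch_neg, poch_neg, e3, e4, e5, e6, e7, poch_add _ k, poch_add _ (t + q + 1) r,
    poch_add (a + k + 1) t q]
  have h1 : 0 < poch (a + b + 1 + k + t) k := poch_pos (by positivity) _
  have h2 : 0 < poch (a + b + 1 + k + t + k) (t + q + 1) := poch_pos (by positivity) _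
  have h3 : 0 < poch (a + b + 1 + k + t + k + (t + q + 1 : ℕ)) r := poch_pos (by positivity) _
  have h4 : (-1 : ℝ) ^ t * (-1) ^ t = 1 := by rw [← mul_pow]; simp
  rw [pow_add, pow_add]
  field_simp
  linear_combination -(a + b + 1 + 2 * k + 2 * t) * poch (a + k + 1 + t) q * x ^ r *
    poch (a + k + 1) t * h4

/-- The coefficientwise form of the inversion formula for Jacobi polynomials: the coefficient of
`((y - 1) / 2) ^ k` in
`∑ j, (a + b + 2 j + 1) / (a + b + j + 1)_{i+1} P_{i-j}^{(-a-i-1,-b-i-1)}(x) P_j^{(a,b)}(y)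
= ((y - x) / 2) ^ i / i!`, where `i = k + N`. -/
lemma jacobiP_inversion {a b : ℝ} {k : ℕ} (h : 0 < a + b + 1 + k) (x : ℝ) (N : ℕ) :
    ∑ t ∈ Finset.range (N + 1),
      (a + b + 2 * (k + t : ℝ) + 1) / poch (a + b + 1 + k + t) (k + N + 1) *
      jacobiP (-a - (k + N : ℝ) - 1) (-b - (k + N : ℝ) - 1) (N - t) x *
      (poch (k + t + a + b + 1) k / k.factorial * (poch (a + k + 1) t / t.factorial)) =
    (-1) ^ N * ((x - 1) / 2) ^ N / (k.factorial * N.factorial) := by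
  set z := (x - 1) / 2
  have hterm : ∀ t ∈ Finset.range (N + 1),
      (a + b + 2 * (k + t : ℝ) + 1) / poch (a + b + 1 + k + t) (k + N + 1) *
      jacobiP (-a - (k + N : ℝ) - 1) (-b - (k + N : ℝ) - 1) (N - t) x *
      (poch (k + t + a + b + 1) k / k.factorial * (poch (a + k + 1) t / t.factorial)) =
      ∑ r ∈ Finset.range (N - t + 1),
        (-1) ^ N * z ^ r / (r.factorial * k.factorial) * poch (a + k + 1) (N - r) *
        ((-1 : ℝ) ^ t * (a + b + 1 + 2 * k + 2 * t) /
        (poch (a + b + 1 + 2 * k + t) (N - r + 1) * t.factorial * (N - r - t).factorial)) := by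
    intro t ht
    rw [jacobiP, Finset.mul_sum, Finset.sum_mul]
    refine Finset.sum_congr rfl fun r hr => ?_
    rw [Finset.mem_range] at ht hr
    obtain ⟨q, rfl⟩ : ∃ q, N = t + r + q := ⟨N - t - r, by omega⟩
    have := inversion_term h z t r q
    rw [show t + r + q - t = r + q by omega, show r + q - r = q by omega,
      show t + r + q - r = t + q by omega, show t + q - t = q by omega, ← this]
    push_cast
    rfl
  rw [Finset.sum_congr rfl hterm, Finset.sum_comm' (s' := fun r => Finset.range (N - r + 1))
    (t' := Finset.range (N + 1)) (by simp only [Finset.mem_range]; omega)]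
  simp_rw [← Finset.mul_sum]
  have hS : 0 < a + b + 1 + 2 * (k : ℝ) := by
    have : (0 : ℝ) ≤ k := by positivity
    linarith
  simp_rw [sum_alternating_div_factorial hS]
  rw [Finset.sum_range_succ, Finset.sum_eq_zero]
  · simp [poch_zero, mul_comm]
  · intro r hr
    rw [Finset.mem_range] at hr
    rw [if_neg (by omega), mul_zero]

/-- The coefficient of `((x - 1) / 2) ^ m` in `jacobiP_connection`, for `J = m + N`. -/
lemma connection_coeff {α β : ℝ} (hβ : -1 < β) (m N : ℕ) :
    ∑ t ∈ Finset.range (N + 1),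
      poch ((m + N : ℝ) + α + β + 3) (m + t + 1) * poch (α + 3 + (m + t)) (N - t) /
        ((m + t + 1).factorial * (N - t).factorial) *
      ((-1) ^ (m + t) * poch (α + 3) (m + t) / poch (β + 1) (m + t)) *
      (poch (-α - 2) t * poch (α + β + 3) m * (-1) ^ m / (t.factorial * m.factorial)) =
    poch (α + 3) (m + N) * poch (α + β + 3) (m + N + 1) /
      (poch (β + 1) (m + N) * (m + N + 1).factorial) *
      (poch ((m + N : ℝ) + (α + 3) + β + 1) m / m.factorial *
        (poch (α + 3 + m + 1) N / N.factorial)) := by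
  have hC := sum_choose_mul_poch_saalschutz (-α - 2) (α + β + (m + N : ℝ) + m + 4) (β + 1 + m) N
  have hE : β + 1 + m - (-α - 2) - (α + β + (m + N : ℝ) + m + 4) = -((m + N + 1 : ℕ) : ℝ) := by
    push_cast; ring
  have hCA : β + 1 + m - (-α - 2) = α + β + 3 + m := by ring
  have hCB : β + 1 + m - (α + β + (m + N : ℝ) + m + 4) = -(α + 3 + m + N) := by ring
  rw [hE, hCA, hCB, poch_neg, show α + 3 + m + N - (N : ℝ) + 1 = α + 3 + m + 1 by ring] at hC
  have hb : ∀ n, 0 < poch (β + 1) n := fun n => poch_pos (by linarith) n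
  have hterm : ∀ t ∈ Finset.range (N + 1),
      poch ((m + N : ℝ) + α + β + 3) (m + t + 1) * poch (α + 3 + (m + t)) (N - t) /
        ((m + t + 1).factorial * (N - t).factorial) *
      ((-1) ^ (m + t) * poch (α + 3) (m + t) / poch (β + 1) (m + t)) *
      (poch (-α - 2) t * poch (α + β + 3) m * (-1) ^ m / (t.factorial * m.factorial)) =
      poch (α + 3) (m + N) * poch (α + β + 3) m * poch ((m + N : ℝ) + α + β + 3) (m + 1) *
        (-1) ^ N / (m.factorial * N.factorial * (m + N + 1).factorial * poch (β + 1) (m + N)) *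
      ((N.choose t : ℝ) * poch (-α - 2) t * poch (α + β + (m + N : ℝ) + m + 4) t *
        poch (β + 1 + m + t) (N - t) * poch (-((m + N + 1 : ℕ) : ℝ)) (N - t)) := by
    intro t ht
    obtain ⟨s, rfl⟩ := Nat.exists_eq_add_of_le (Nat.lt_succ_iff.mp (Finset.mem_range.mp ht))
    rw [Nat.cast_choose ℝ (Nat.le_add_right t s), Nat.add_sub_cancel_left,
      show m + (t + s) + 1 = m + t + 1 + s by ring, poch_neg_natCast,
      show m + (t + s) = m + t + s by ring, poch_add (α + 3) (m + t) s,
      poch_add (β + 1) (m + t) s, show m + t + 1 = m + 1 + t by ring,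
      poch_add _ (m + 1) t]
    have e1 : (m + (t + s : ℕ) : ℝ) + α + β + 3 + (m + 1 : ℕ) =
        α + β + (m + (t + s : ℕ) : ℝ) + m + 4 := by push_cast; ring
    have e2 : β + 1 + ((m + t : ℕ) : ℝ) = β + 1 + m + t := by push_cast; ring
    have e3 : α + 3 + ((m + t : ℕ) : ℝ) = α + 3 + (m + t) := by push_cast; ring
    rw [e1, e2, e3]
    have h1 := hb (m + t)
    have h2 : 0 < poch (β + 1 + m + t) s :=
      poch_pos (by linarith [(Nat.cast_nonneg m : (0 : ℝ) ≤ m), (Nat.cast_nonneg t : (0 : ℝ) ≤ t)]) s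
    simp only [pow_add]
    rcases neg_one_pow_eq_or ℝ m with hm | hm <;> rcases neg_one_pow_eq_or ℝ s with hs | hs <;>
      rw [hm, hs] <;> field_simp
  rw [Finset.sum_congr rfl hterm, ← Finset.mul_sum, hC,
    show m + N + 1 = (m + N) + 1 by ring, poch_succ (α + β + 3) (m + N),
    poch_add (α + β + 3) m N, poch_succ_left _ m,
    show (m + N : ℝ) + α + β + 3 + 1 = (m + N : ℝ) + (α + 3) + β + 1 by ring]
  have h4 : (-1 : ℝ) ^ N * (-1) ^ N = 1 := by rw [← mul_pow]; simp
  have := hb (m + N)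
  push_cast
  field_simp
  linear_combination poch (α + 3) (m + N) * poch (α + β + 3) m *
    poch (m + N + (α + 3) + β + 1) m * poch (α + β + 3 + m) N * poch (α + 3 + m + 1) N *
    (m + N + α + β + 3) * h4

/-- The coefficient of `t ^ n` in `(1 - t) ^ (α + 2) * (1 + z t) ^ (-α - β - 3)`. -/
noncomputable def binomialProductCoeff (α β : ℝ) (n : ℕ) (z : ℝ) : ℝ :=
  ∑ m ∈ Finset.range (n + 1),
    poch (-α - 2) (n - m) * poch (α + β + 3) m * (-1) ^ m / ((n - m).factorial * m.factorial) *
      z ^ m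

/-- Expansion of `P_J^{(α+3,β)}` in the products `binomialProductCoeff`, with the coefficients of
`P_{J+1}^{(α+1,β)}` as weights. -/
lemma jacobiP_connection {α β : ℝ} (hβ : -1 < β) (J : ℕ) (x : ℝ) :
    poch (α + 3) J * poch (α + β + 3) (J + 1) / (poch (β + 1) J * (J + 1).factorial) *
      jacobiP (α + 3) β J x =
    ∑ n ∈ Finset.range (J + 1),
      poch (J + α + β + 3) (n + 1) * poch (α + 3 + n) (J - n) /
        ((n + 1).factorial * (J - n).factorial) *
      ((-1) ^ n * poch (α + 3) n / poch (β + 1) n *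
        binomialProductCoeff α β n ((x - 1) / 2)) := by
  set z := (x - 1) / 2
  let f : ℕ → ℕ → ℝ := fun m t =>
    poch (J + α + β + 3) (m + t + 1) * poch (α + 3 + (m + t : ℕ)) (J - (m + t)) /
        ((m + t + 1).factorial * (J - (m + t)).factorial) *
      ((-1) ^ (m + t) * poch (α + 3) (m + t) / poch (β + 1) (m + t)) *
      (poch (-α - 2) t * poch (α + β + 3) m * (-1) ^ m / (t.factorial * m.factorial)) * z ^ m
  have h1 : ∀ n ∈ Finset.range (J + 1),
      poch (J + α + β + 3) (n + 1) * poch (α + 3 + n) (J - n) /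
        ((n + 1).factorial * (J - n).factorial) *
      ((-1) ^ n * poch (α + 3) n / poch (β + 1) n * binomialProductCoeff α β n z) =
      ∑ m ∈ Finset.range (n + 1), f m (n - m) := by
    intro n _
    rw [binomialProductCoeff, Finset.mul_sum, Finset.mul_sum]
    refine Finset.sum_congr rfl fun m hm => ?_
    simp only [f]
    rw [Nat.add_sub_cancel' (Nat.lt_succ_iff.mp (Finset.mem_range.mp hm))]
    ring
  rw [Finset.sum_congr rfl h1, Finset.sum_range_diag_flip, jacobiP, Finset.mul_sum]
  refine Finset.sum_congr rfl fun m hm => ?_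
  obtain ⟨N, rfl⟩ := Nat.exists_eq_add_of_le (Nat.lt_succ_iff.mp (Finset.mem_range.mp hm))
  rw [Nat.add_sub_cancel_left, show m + N + 1 - m = N + 1 by omega, ← Finset.sum_mul,
    ← mul_assoc]
  congr 1
  rw [Nat.cast_add, ← connection_coeff hβ m N]
  refine Finset.sum_congr rfl fun t _ => ?_
  rw [show m + N - (m + t) = N - t by omega]
  push_cast
  rfl

lemma poch_mul_poch_regroup {α β : ℝ} (hβ : -1 < β) (z : ℝ) (k m d : ℕ) :
    (-1 : ℝ) ^ (k + m + d) *
      (poch (α + 3) k * poch (-α - 2) k /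
        (poch (β + 1) k * (k + 1).factorial * (m + d).factorial * k.factorial) *
        (poch (-((m + d : ℕ) : ℝ)) m * poch (α + 3 + k) m * poch (α + β + 3) m /
          (poch (β + 1 + k) m * poch ((k + 1 : ℕ) + 1) m * m.factorial)) * z ^ (m + d)) =
    (-1) ^ (k + m) * poch (α + 3) (k + m) / poch (β + 1) (k + m) *
      (poch (-α - 2) k * poch (α + β + 3) m * (-1) ^ m / (k.factorial * m.factorial) * z ^ m) *
      ((-1) ^ d * z ^ d / ((k + m + 1).factorial * d.factorial)) := by
  rw [add_comm m d, poch_neg_natCast, poch_natCast_add_one, poch_add (α + 3), poch_add (β + 1),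
    show k + 1 + m = k + m + 1 by ring]
  have h1 : 0 < poch (β + 1) k := poch_pos (by linarith) _
  have h2 : 0 < poch (β + 1 + k) m :=
    poch_pos (by linarith [(Nat.cast_nonneg k : (0 : ℝ) ≤ k)]) _
  field_simp
  ring

/-- the key sum identity used to compute the coefficients `b_i(α,β,x)`. -/
theorem sum_identity_b (α β : ℝ) (hα : -1 < α) (hβ : -1 < β) (i : ℕ) (hi : 1 ≤ i) (x : ℝ) :
    ∑ j ∈ Finset.Icc 1 i,
      (α + β + 2 * j + 2) / poch (α + β + (j : ℝ) + 2) (i + 1) *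
        (poch (α + 3) (j - 1) * poch (α + β + 3) j /
          (poch (β + 1) (j - 1) * Nat.factorial j)) *
        jacobiP (-α - (i : ℝ) - 2) (-β - (i : ℝ) - 1) (i - j) x *
        jacobiP (α + 3) β (j - 1) x
    = (-1 : ℝ) ^ (i - 1) *
        ∑ ℓ ∈ Finset.range i,
          poch (α + 3) (i - ℓ - 1) * poch (-α - 2) (i - ℓ - 1) /
            (poch (β + 1) (i - ℓ - 1) * Nat.factorial (i - ℓ) * Nat.factorial ℓ *
              Nat.factorial (i - ℓ - 1)) *
          (∑ m ∈ Finset.range (ℓ + 1),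
            poch (-(ℓ : ℝ)) m * poch (α + (i : ℝ) - (ℓ : ℝ) + 2) m * poch (α + β + 3) m /
              (poch (β + (i : ℝ) - (ℓ : ℝ)) m * poch ((i : ℝ) - (ℓ : ℝ) + 1) m *
                Nat.factorial m)) *
          ((x - 1) / 2) ^ ℓ := by
  obtain ⟨I, rfl⟩ : ∃ I, i = I + 1 := ⟨i - 1, by omega⟩
  set z := (x - 1) / 2
  let τ : ℕ → ℝ := fun n =>
    (-1) ^ n * poch (α + 3) n / poch (β + 1) n * binomialProductCoeff α β n z
  let h : ℕ → ℕ → ℝ := fun n t =>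
    (α + β + 2 * ((n + t : ℕ) : ℝ) + 4) / poch (α + β + ((n + t : ℕ) : ℝ) + 3) (I + 2) *
      jacobiP (-α - ((I : ℝ) + 1) - 2) (-β - ((I : ℝ) + 1) - 1) (I - (n + t)) x *
      (poch (((n + t : ℕ) : ℝ) + α + β + 3) (n + 1) * poch (α + 3 + n) t /
        ((n + 1).factorial * t.factorial)) * τ n
  let g : ℕ → ℕ → ℝ := fun m k =>
    (-1) ^ (k + m) * poch (α + 3) (k + m) / poch (β + 1) (k + m) *
      (poch (-α - 2) k * poch (α + β + 3) m * (-1) ^ m / (k.factorial * m.factorial) * z ^ m) *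
      ((-1) ^ (I - (k + m)) * z ^ (I - (k + m)) /
        ((k + m + 1).factorial * (I - (k + m)).factorial))
  have hI : Finset.Icc 1 (I + 1) = Finset.Ico 1 (I + 2) := by
    ext; simp only [Finset.mem_Icc, Finset.mem_Ico]; omega
  have hL : ∀ J ∈ Finset.range (I + 1),
      (α + β + 2 * ((1 + J : ℕ) : ℝ) + 2) / poch (α + β + ((1 + J : ℕ) : ℝ) + 2) (I + 1 + 1) *
        (poch (α + 3) (1 + J - 1) * poch (α + β + 3) (1 + J) /
          (poch (β + 1) (1 + J - 1) * Nat.factorial (1 + J))) *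
        jacobiP (-α - ((I + 1 : ℕ) : ℝ) - 2) (-β - ((I + 1 : ℕ) : ℝ) - 1) (I + 1 - (1 + J)) x *
        jacobiP (α + 3) β (1 + J - 1) x = ∑ n ∈ Finset.range (J + 1), h n (J - n) := by
    intro J _
    have hc := jacobiP_connection (α := α) hβ J x
    rw [show 1 + J - 1 = J by omega, show I + 1 - (1 + J) = I - J by omega, add_comm 1 J,
      mul_right_comm, mul_assoc _ _ (jacobiP (α + 3) β J x), mul_right_comm, hc, Finset.mul_sum]
    refine Finset.sum_congr rfl fun n hn => ?_
    simp only [h, τ]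
    rw [Nat.add_sub_cancel' (Nat.lt_succ_iff.mp (Finset.mem_range.mp hn)), ← mul_assoc,
      show α + β + 2 * ((J + 1 : ℕ) : ℝ) + 2 = α + β + 2 * J + 4 by push_cast; ring,
      show α + β + ((J + 1 : ℕ) : ℝ) + 2 = α + β + J + 3 by push_cast; ring]
    push_cast
    rfl
  have hL' : ∀ n ∈ Finset.range (I + 1), ∑ t ∈ Finset.range (I + 1 - n), h n t =
      τ n * ((-1) ^ (I - n) * z ^ (I - n) / ((n + 1).factorial * (I - n).factorial)) := by
    intro n hn
    obtain ⟨N, rfl⟩ := Nat.exists_eq_add_of_le (Nat.lt_succ_iff.mp (Finset.mem_range.mp hn))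
    have hinv := jacobiP_inversion (a := α + 1) (b := β) (k := n + 1)
      (by push_cast; linarith [(Nat.cast_nonneg n : (0 : ℝ) ≤ n)]) x N
    rw [Nat.add_sub_cancel_left, show n + N + 1 - n = N + 1 by omega, ← hinv, Finset.mul_sum]
    refine Finset.sum_congr rfl fun t _ => ?_
    simp only [h]
    rw [show n + N - (n + t) = N - t by omega, show n + 1 + N + 1 = n + N + 2 by ring,
      show α + 1 + β + 2 * (((n + 1 : ℕ) : ℝ) + t) + 1 = α + β + 2 * ((n + t : ℕ) : ℝ) + 4 by
        push_cast; ring,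
      show α + 1 + β + 1 + ((n + 1 : ℕ) : ℝ) + t = α + β + ((n + t : ℕ) : ℝ) + 3 by
        push_cast; ring,
      show -(α + 1) - (((n + 1 : ℕ) : ℝ) + N) - 1 = -α - (((n + N : ℕ) : ℝ) + 1) - 2 by
        push_cast; ring,
      show -β - (((n + 1 : ℕ) : ℝ) + N) - 1 = -β - (((n + N : ℕ) : ℝ) + 1) - 1 by
        push_cast; ring,
      show ((n + 1 : ℕ) : ℝ) + t + (α + 1) + β + 1 = ((n + t : ℕ) : ℝ) + α + β + 3 by
        push_cast; ring,
      show α + 1 + ((n + 1 : ℕ) : ℝ) + 1 = α + 3 + n by push_cast; ring]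
    ring
  have hR : ∀ k ∈ Finset.range (I + 1), (-1 : ℝ) ^ (I + 1 - 1) *
      (poch (α + 3) (I + 1 - (I + 1 - 1 - k) - 1) * poch (-α - 2) (I + 1 - (I + 1 - 1 - k) - 1) /
            (poch (β + 1) (I + 1 - (I + 1 - 1 - k) - 1) * Nat.factorial (I + 1 - (I + 1 - 1 - k)) *
              Nat.factorial (I + 1 - 1 - k) * Nat.factorial (I + 1 - (I + 1 - 1 - k) - 1)) *
          (∑ m ∈ Finset.range (I + 1 - 1 - k + 1),
            poch (-((I + 1 - 1 - k : ℕ) : ℝ)) m *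
              poch (α + ((I + 1 : ℕ) : ℝ) - ((I + 1 - 1 - k : ℕ) : ℝ) + 2) m *
              poch (α + β + 3) m /
              (poch (β + ((I + 1 : ℕ) : ℝ) - ((I + 1 - 1 - k : ℕ) : ℝ)) m *
                poch (((I + 1 : ℕ) : ℝ) - ((I + 1 - 1 - k : ℕ) : ℝ) + 1) m *
                Nat.factorial m)) * z ^ (I + 1 - 1 - k)) =
      ∑ m ∈ Finset.range (I + 1 - k), g m k := by
    intro k hk
    rw [Finset.mem_range] at hk
    rw [Nat.add_sub_cancel, show I + 1 - (I - k) = k + 1 by omega, Nat.add_sub_cancel,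
      show I + 1 - k = I - k + 1 by omega, Finset.mul_sum, Finset.sum_mul, Finset.mul_sum]
    refine Finset.sum_congr rfl fun m hm => ?_
    rw [Finset.mem_range] at hm
    obtain ⟨d, rfl⟩ : ∃ d, I = k + m + d := ⟨I - k - m, by omega⟩
    simp only [g]
    rw [show k + m + d - k = m + d by omega, Nat.add_sub_cancel_left,
      ← poch_mul_poch_regroup hβ z k m d,
      show α + ((k + m + d + 1 : ℕ) : ℝ) - ((m + d : ℕ) : ℝ) + 2 = α + 3 + k by
        push_cast; ring,
      show β + ((k + m + d + 1 : ℕ) : ℝ) - ((m + d : ℕ) : ℝ) = β + 1 + k by push_cast; ring,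
      show ((k + m + d + 1 : ℕ) : ℝ) - ((m + d : ℕ) : ℝ) + 1 = (k + 1 : ℕ) + 1 by
        push_cast; ring]
  rw [hI, Finset.sum_Ico_eq_sum_range, show I + 2 - 1 = I + 1 by omega, Finset.sum_congr rfl hL,
    Finset.sum_range_diag_flip, Finset.sum_congr rfl hL', Finset.mul_sum]
  symm
  rw [← Finset.sum_range_reflect, Finset.sum_congr rfl hR,
    Finset.sum_comm' (s' := fun m => Finset.range (I + 1 - m)) (t' := Finset.range (I + 1))
      (by simp only [Finset.mem_range]; omega), ← Finset.sum_range_diag_flip]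
  refine Finset.sum_congr rfl fun n _ => ?_
  simp only [τ, binomialProductCoeff]
  rw [Finset.mul_sum, Finset.sum_mul]
  refine Finset.sum_congr rfl fun m hm => ?_
  simp only [g]
  rw [Nat.sub_add_cancel (Nat.lt_succ_iff.mp (Finset.mem_range.mp hm))]
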